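/- arXiv:1709.10157 — 5 statements merged into one kernel-verified Lean document; each statement's English description precedes it below -/
import Mathlib

section
/- Suppose W is an m×m real symmetric matrix with nonnegative entries and positive diagonal entries whose Laplacian L = D − W has kernel exactly the span of the all-ones vector 1_m (connected graph), κ_1,…,κ_m > 0, c̄ > 0, c ≥ 0, the matrix D K D − W K W is positive semidefinite, and moreover c > 0 whenever there exists a nonzero vector u ∈ ℝ^{mn} with Āu = 0, (D̄K̄D̄ − W̄K̄W̄)u = 0 and L̄u ≠ 0. Let x, z : ℕ → ℝ^{mn} be any sequences satisfying, for all t, the implicit update equations x(t+1) = x(t) − c̄K̄(Ā'Ā x(t+1) − Ā'b) − K̄(D̄ z(t+1) − W̄ z(t)) − cK̄(D̄ x(t+1) − W̄ x(t)) and z(t+1) = z(t) + K̄(D̄ x(t+1) − W̄ x(t)). Then there exist a vector x* ∈ ℝ^n minimizing y ↦ (1/2)Σ_{i=1}^m ‖A_i y − b_i‖² over ℝ^n, and constants C ≥ 0 and r ∈ [0,1), such that ‖x(t) − 1_m ⊗ x*‖ ≤ C·r^t for all t; in particular every agent's state converges exponentially fast to the same least squares solution of Ax = b. -/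
open Matrix
open scoped Kronecker

noncomputable section

/-- `M̄ = M ⊗ I_n`. -/
def bar (n : ℕ) {m : ℕ} (M : Matrix (Fin m) (Fin m) ℝ) :
    Matrix (Fin m × Fin n) (Fin m × Fin n) ℝ :=
  M ⊗ₖ (1 : Matrix (Fin n) (Fin n) ℝ)

/-- `D`: the diagonal matrix of row sums of `W`. -/
def rowSumDiag {m : ℕ} (W : Matrix (Fin m) (Fin m) ℝ) : Matrix (Fin m) (Fin m) ℝ :=
  Matrix.diagonal fun i => ∑ j, W i j

/-- `Ā = blockdiag(A_1, …, A_m)`. -/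
def blockDiag {m n : ℕ} (ni : Fin m → ℕ) (A : ∀ i, Matrix (Fin (ni i)) (Fin n) ℝ) :
    Matrix ((i : Fin m) × Fin (ni i)) (Fin m × Fin n) ℝ :=
  fun p q => if p.1 = q.1 then A p.1 p.2 q.2 else 0

/-- `b = col(b_1, …, b_m)`. -/
def bvec {m : ℕ} {ni : Fin m → ℕ} (b : ∀ i, Fin (ni i) → ℝ) :
    (i : Fin m) × Fin (ni i) → ℝ := fun p => b p.1 p.2

/-- On a finite-dimensional space, a nonnegative bilinear form whose diagonal vanishes wherever
that of a symmetric nonnegative form `R` does is dominated by a multiple of `R`. -/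
theorem exists_le_mul_of_nonneg_form {E : Type*} [AddCommGroup E] [Module ℝ E]
    [FiniteDimensional ℝ E] (P R : LinearMap.BilinForm ℝ E) (hP : ∀ w, 0 ≤ P w w)
    (hRs : R.IsSymm) (hR : ∀ w, 0 ≤ R w w) (h : ∀ w, R w w = 0 → P w w = 0) :
    ∃ C : ℝ, 1 ≤ C ∧ ∀ w, P w w ≤ C * R w w := by
  have : Invertible (2 : ℝ) := invertibleOfNonzero two_ne_zero
  obtain ⟨v, hv⟩ :=
    LinearMap.BilinForm.exists_orthogonal_basis (LinearMap.BilinForm.isSymm_iff.1 hRs)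
  obtain ⟨n, hn⟩ : ∃ n : ℝ, n = Module.finrank ℝ E := ⟨_, rfl⟩
  have hbound : ∀ i, 0 ≤ P (v i) (v i) / R (v i) (v i) := fun i => div_nonneg (hP _) (hR _)
  set c : ℝ := ∑ i, P (v i) (v i) / R (v i) (v i)
  have hc0 : 0 ≤ c := Finset.sum_nonneg fun i _ => hbound i
  have hdiag : ∀ i, P (v i) (v i) ≤ c * R (v i) (v i) := by
    intro i
    rcases (hR (v i)).eq_or_lt with h0 | h0
    · rw [h _ h0.symm, ← h0, mul_zero]
    · rw [← div_le_iff₀ h0]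
      exact Finset.single_le_sum (f := fun i => P (v i) (v i) / R (v i) (v i))
        (fun i _ => hbound i) (Finset.mem_univ i)
  have hn0 : 0 ≤ n := hn ▸ Nat.cast_nonneg _
  refine ⟨n * c + 1, by nlinarith [mul_nonneg hn0 hc0], fun w => ?_⟩
  have hexp : ∀ F : LinearMap.BilinForm ℝ E,
      F w w = ∑ i, ∑ j, v.repr w i * v.repr w j * F (v i) (v j) := by
    intro F
    conv_lhs => rw [← v.sum_repr w]
    simp only [map_sum, LinearMap.sum_apply, map_smul, LinearMap.smul_apply, smul_eq_mul,
      Finset.mul_sum]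
    rw [Finset.sum_comm]
    exact Finset.sum_congr rfl fun i _ => Finset.sum_congr rfl fun j _ => by ring
  have hRw : R w w = ∑ i, v.repr w i ^ 2 * R (v i) (v i) := by
    rw [hexp R]
    refine Finset.sum_congr rfl fun i _ => ?_
    rw [Finset.sum_eq_single i]
    · ring
    · intro j _ hj
      have : R (v i) (v j) = 0 := hv hj.symm
      rw [this, mul_zero]
    · simp
  have hcross : ∀ i j, v.repr w i * v.repr w j * P (v i) (v j) +
      v.repr w j * v.repr w i * P (v j) (v i) ≤
      v.repr w i ^ 2 * P (v i) (v i) + v.repr w j ^ 2 * P (v j) (v j) := by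
    intro i j
    have := hP (v.repr w i • v i - v.repr w j • v j)
    simp only [map_sub, map_smul, LinearMap.sub_apply, LinearMap.smul_apply, smul_eq_mul] at this
    nlinarith
  have hPw : P w w ≤ n * ∑ i, v.repr w i ^ 2 * P (v i) (v i) := by
    have h1 : P w w + P w w ≤
        ∑ i, ∑ j, (v.repr w i ^ 2 * P (v i) (v i) + v.repr w j ^ 2 * P (v j) (v j)) := by
      nth_rewrite 2 [hexp P]
      rw [Finset.sum_comm, hexp P, ← Finset.sum_add_distrib]
      refine Finset.sum_le_sum fun i _ => ?_
      rw [← Finset.sum_add_distrib]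
      refine Finset.sum_le_sum fun j _ => ?_
      linarith [hcross i j]
    simp only [Finset.sum_add_distrib, Finset.sum_const, Finset.card_univ, Fintype.card_fin,
      nsmul_eq_mul, ← Finset.mul_sum, ← hn] at h1
    linarith
  calc P w w ≤ n * ∑ i, v.repr w i ^ 2 * P (v i) (v i) := hPw
    _ ≤ n * ∑ i, v.repr w i ^ 2 * (c * R (v i) (v i)) := by
        gcongr with i _
        exact hdiag i
    _ = n * c * R w w := by
        rw [hRw, Finset.mul_sum, Finset.mul_sum]
        exact Finset.sum_congr rfl fun i _ => by ring
    _ ≤ (n * c + 1) * R w w := by nlinarith [hR w]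

section EnergyMethod

variable {ι : Type*} [Fintype ι]

theorem dotProduct_mulVec_comm {M : Matrix ι ι ℝ} (hM : M.IsSymm) (u v : ι → ℝ) :
    u ⬝ᵥ M *ᵥ v = v ⬝ᵥ M *ᵥ u := by
  rw [dotProduct_mulVec, ← mulVec_transpose, hM.eq, dotProduct_comm]

theorem mulVec_dotProduct_comm {M : Matrix ι ι ℝ} (hM : M.IsSymm) (u v : ι → ℝ) :
    (M *ᵥ u) ⬝ᵥ v = u ⬝ᵥ M *ᵥ v := by
  rw [dotProduct_comm, dotProduct_mulVec_comm hM]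

/-- The energy of two consecutive states of the recursion `P x₂ - B x₁ + N x₀ = 0`. -/
def energy (P N B : Matrix ι ι ℝ) (a b : ι → ℝ) : ℝ :=
  b ⬝ᵥ (P + N) *ᵥ b + a ⬝ᵥ (P + N) *ᵥ a - 2 * (b ⬝ᵥ B *ᵥ a)

theorem energy_step {P N B : Matrix ι ι ℝ} (hP : P.IsSymm) (hN : N.IsSymm) (hB : B.IsSymm)
    {x₀ x₁ x₂ : ι → ℝ} (h : P *ᵥ x₂ - B *ᵥ x₁ + N *ᵥ x₀ = 0) :
    energy P N B x₁ x₂ + (x₂ - x₀) ⬝ᵥ (P - N) *ᵥ (x₂ - x₀) = energy P N B x₀ x₁ := by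
  have h2 := congrArg (fun y => x₂ ⬝ᵥ y) h
  have h0 := congrArg (fun y => x₀ ⬝ᵥ y) h
  simp only [energy, add_mulVec, sub_mulVec, mulVec_sub, dotProduct_add, dotProduct_sub,
    sub_dotProduct, dotProduct_zero] at h2 h0 ⊢
  linarith [dotProduct_mulVec_comm hP x₀ x₂, dotProduct_mulVec_comm hN x₀ x₂,
    dotProduct_mulVec_comm hB x₀ x₁]

theorem two_mul_energy {P N B : Matrix ι ι ℝ} (hB : B.IsSymm) (a b : ι → ℝ) :
    2 * energy P N B a b = (b + a) ⬝ᵥ (P + N - B) *ᵥ (b + a) +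
      (b - a) ⬝ᵥ (P + N + B) *ᵥ (b - a) := by
  simp only [energy, add_mulVec, sub_mulVec, mulVec_sub, mulVec_add, dotProduct_add,
    dotProduct_sub, sub_dotProduct, add_dotProduct]
  linarith [dotProduct_mulVec_comm hB a b]

theorem energy_eq_zero {P N B : Matrix ι ι ℝ} (hB : B.IsSymm)
    {a b : ι → ℝ} (ha : P *ᵥ a - B *ᵥ b + N *ᵥ a = 0) (hb : P *ᵥ b - B *ᵥ a + N *ᵥ b = 0) :
    energy P N B a b = 0 := by
  have h2 := congrArg (fun y => a ⬝ᵥ y) ha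
  have h0 := congrArg (fun y => b ⬝ᵥ y) hb
  simp only [energy, add_mulVec, dotProduct_add, dotProduct_sub, dotProduct_zero] at h2 h0 ⊢
  linarith [dotProduct_mulVec_comm hB a b]

/-- The energy decays geometrically along a trajectory whose windows lie in a subspace on which
the energy is dissipated unless the trajectory is two-periodic. -/
theorem energy_geometric [DecidableEq ι] {P N B : Matrix ι ι ℝ}
    (hP : P.IsSymm) (hN : N.IsSymm) (hB : B.IsSymm)
    (hsub : ∀ v, 0 ≤ v ⬝ᵥ (P + N - B) *ᵥ v) (hadd : ∀ v, 0 ≤ v ⬝ᵥ (P + N + B) *ᵥ v)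
    (hdiff : ∀ v, 0 ≤ v ⬝ᵥ (P - N) *ᵥ v)
    (E : Submodule ℝ (Fin 4 → ι → ℝ))
    (hE₀ : ∀ w ∈ E, P *ᵥ w 2 - B *ᵥ w 1 + N *ᵥ w 0 = 0)
    (hE₁ : ∀ w ∈ E, P *ᵥ w 3 - B *ᵥ w 2 + N *ᵥ w 1 = 0)
    (hE₂ : ∀ w ∈ E, (w 2 - w 0) ⬝ᵥ (P - N) *ᵥ (w 2 - w 0) = 0 → w 2 = w 0)
    (hE₃ : ∀ w ∈ E, (w 3 - w 1) ⬝ᵥ (P - N) *ᵥ (w 3 - w 1) = 0 → w 3 = w 1)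
    (x : ℕ → ι → ℝ) (hx : ∀ t, ![x t, x (t + 1), x (t + 2), x (t + 3)] ∈ E) :
    ∃ C ρ : ℝ, 0 ≤ C ∧ 0 ≤ ρ ∧ ρ < 1 ∧ ∀ t, energy P N B (x t) (x (t + 1)) ≤ C * ρ ^ t := by
  have hpos : ∀ a b, 0 ≤ energy P N B a b := fun a b => by
    linarith [two_mul_energy (P := P) (N := N) hB a b, hsub (b + a), hadd (b - a)]
  let p : Fin 4 → E →ₗ[ℝ] (ι → ℝ) := fun i => LinearMap.proj i ∘ₗ E.subtype
  let form : Matrix ι ι ℝ → (E →ₗ[ℝ] (ι → ℝ)) → (E →ₗ[ℝ] (ι → ℝ)) → LinearMap.BilinForm ℝ E :=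
    fun M f g => (Matrix.toBilin' M).comp f g
  have form_apply : ∀ M f g v w, form M f g v w = f v ⬝ᵥ M *ᵥ g w := fun M f g v w => by
    simp only [form, LinearMap.BilinForm.comp_apply, Matrix.toBilin'_apply']
  let U : Fin 4 → Fin 4 → LinearMap.BilinForm ℝ E := fun i j =>
    form (P + N) (p j) (p j) + form (P + N) (p i) (p i) - (2 : ℝ) • form B (p j) (p i)
  have U_apply : ∀ i j (w : E), U i j w w = energy P N B (w.1 i) (w.1 j) := fun i j w => by
    simp only [U, LinearMap.sub_apply, LinearMap.add_apply, LinearMap.smul_apply, form_apply,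
      energy, smul_eq_mul]
    rfl
  let R : LinearMap.BilinForm ℝ E :=
    form (P - N) (p 2 - p 0) (p 2 - p 0) + form (P - N) (p 3 - p 1) (p 3 - p 1)
  have R_apply : ∀ w : E, R w w = (w.1 2 - w.1 0) ⬝ᵥ (P - N) *ᵥ (w.1 2 - w.1 0) +
      (w.1 3 - w.1 1) ⬝ᵥ (P - N) *ᵥ (w.1 3 - w.1 1) := fun w => by
    simp only [R, LinearMap.add_apply, form_apply]
    rfl
  obtain ⟨C, hC, hle⟩ := exists_le_mul_of_nonneg_form (U 0 1 + U 1 2) R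
    (fun w => by
      simp only [LinearMap.add_apply, U_apply]
      exact add_nonneg (hpos _ _) (hpos _ _))
    ⟨fun v w => by
      simp only [R, LinearMap.add_apply, form_apply]
      rw [dotProduct_mulVec_comm (hP.sub hN) _ ((p 2 - p 0) w),
        dotProduct_mulVec_comm (hP.sub hN) _ ((p 3 - p 1) w)]⟩
    (fun w => by rw [R_apply]; exact add_nonneg (hdiff _) (hdiff _))
    (fun w hw => by
      rw [R_apply, add_eq_zero_iff_of_nonneg (hdiff _) (hdiff _)] at hw
      have h20 := hE₂ w w.2 hw.1
      have h31 := hE₃ w w.2 hw.2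
      have e0 := hE₀ w w.2
      have e1 := hE₁ w w.2
      rw [h20] at e0
      rw [h31, h20] at e1
      simp only [LinearMap.add_apply, U_apply, h20]
      rw [energy_eq_zero hB e0 e1, energy_eq_zero hB e1 e0, add_zero])
  set V : ℕ → ℝ := fun t => energy P N B (x t) (x (t + 1)) + energy P N B (x (t + 1)) (x (t + 2))
  have hV : ∀ t, V (t + 1) ≤ (1 - C⁻¹) * V t := by
    intro t
    have h1 := hle ⟨_, hx t⟩
    rw [R_apply] at h1
    simp only [LinearMap.add_apply, U_apply] at h1
    have h2 := energy_step hP hN hB (hE₀ _ (hx t))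
    have h3 := energy_step hP hN hB (hE₁ _ (hx t))
    change V t ≤ C * ((x (t + 2) - x t) ⬝ᵥ (P - N) *ᵥ (x (t + 2) - x t) +
      (x (t + 3) - x (t + 1)) ⬝ᵥ (P - N) *ᵥ (x (t + 3) - x (t + 1))) at h1
    change energy P N B (x (t + 1)) (x (t + 2)) +
      (x (t + 2) - x t) ⬝ᵥ (P - N) *ᵥ (x (t + 2) - x t) = energy P N B (x t) (x (t + 1)) at h2
    change energy P N B (x (t + 2)) (x (t + 3)) +
      (x (t + 3) - x (t + 1)) ⬝ᵥ (P - N) *ᵥ (x (t + 3) - x (t + 1)) =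
      energy P N B (x (t + 1)) (x (t + 2)) at h3
    rw [← inv_mul_le_iff₀ (by linarith)] at h1
    change energy P N B (x (t + 1)) (x (t + 2)) + energy P N B (x (t + 2)) (x (t + 3)) ≤ _
    have h4 : V t = energy P N B (x t) (x (t + 1)) + energy P N B (x (t + 1)) (x (t + 2)) := rfl
    linarith
  have hρ : 0 ≤ 1 - C⁻¹ := sub_nonneg.2 (inv_le_one_of_one_le₀ hC)
  have hgeo : ∀ t, V t ≤ V 0 * (1 - C⁻¹) ^ t := by
    intro t
    induction t with
    | zero => simp
    | succ t ih =>
      calc V (t + 1) ≤ (1 - C⁻¹) * V t := hV t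
        _ ≤ (1 - C⁻¹) * (V 0 * (1 - C⁻¹) ^ t) := by gcongr
        _ = V 0 * (1 - C⁻¹) ^ (t + 1) := by ring
  refine ⟨V 0, 1 - C⁻¹, add_nonneg (hpos _ _) (hpos _ _), hρ,
    sub_lt_self _ (inv_pos.2 (by linarith)), fun t => le_trans ?_ (hgeo t)⟩
  exact le_add_of_nonneg_right (hpos _ _)

theorem Matrix.PosSemidef.form_nonneg {M : Matrix ι ι ℝ} (hM : M.PosSemidef) (v : ι → ℝ) :
    0 ≤ v ⬝ᵥ M *ᵥ v := by
  simpa using hM.dotProduct_mulVec_nonneg v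

theorem Matrix.PosSemidef.form_eq_zero {M : Matrix ι ι ℝ} (hM : M.PosSemidef) {v : ι → ℝ}
    (h : v ⬝ᵥ M *ᵥ v = 0) : M *ᵥ v = 0 :=
  (hM.dotProduct_mulVec_zero_iff v).1 (by simpa using h)

omit [Fintype ι] in
theorem Matrix.PosSemidef.isSymm {M : Matrix ι ι ℝ} (hM : M.PosSemidef) : M.IsSymm :=
  (conjTranspose_eq_transpose_of_trivial M).symm.trans hM.isHermitian.eq

theorem Matrix.IsSymm.mul_mul_same {M K : Matrix ι ι ℝ} (hM : M.IsSymm) (hK : K.IsSymm) :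
    (M * K * M).IsSymm := by
  simp only [IsSymm, transpose_mul, hM.eq, hK.eq, Matrix.mul_assoc]

theorem form_mul_mul_same {M : Matrix ι ι ℝ} (hM : M.IsSymm) (K : Matrix ι ι ℝ) (v : ι → ℝ) :
    v ⬝ᵥ (M * K * M) *ᵥ v = (M *ᵥ v) ⬝ᵥ K *ᵥ (M *ᵥ v) := by
  rw [← mulVec_mulVec, ← mulVec_mulVec, mulVec_dotProduct_comm hM]

section Recursion

variable [DecidableEq ι]

/-- Leading coefficient of the second-order recursion obeyed by the primal iterates. -/
def leadCoeff (D Q : Matrix ι ι ℝ) (k : ι → ℝ) (c : ℝ) : Matrix ι ι ℝ :=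
  diagonal k⁻¹ + D * diagonal k * D + Q + c • D

/-- Trailing coefficient of the second-order recursion obeyed by the primal iterates. -/
def tailCoeff (W : Matrix ι ι ℝ) (k : ι → ℝ) (c : ℝ) : Matrix ι ι ℝ :=
  diagonal k⁻¹ + W * diagonal k * W + c • W

/-- Middle coefficient of the second-order recursion obeyed by the primal iterates. -/
def midCoeff (D W Q : Matrix ι ι ℝ) (k : ι → ℝ) (c : ℝ) : Matrix ι ι ℝ :=
  (2 : ℝ) • diagonal k⁻¹ + (D * diagonal k * W + W * diagonal k * D) + Q + c • (D + W)

variable (D W Q : Matrix ι ι ℝ) (k : ι → ℝ) (c : ℝ)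

theorem lead_add_tail_sub_mid :
    leadCoeff D Q k c + tailCoeff W k c - midCoeff D W Q k c =
      (D - W) * diagonal k * (D - W) := by
  simp only [leadCoeff, tailCoeff, midCoeff, sub_mul, mul_sub]
  module

theorem lead_add_tail_add_mid :
    leadCoeff D Q k c + tailCoeff W k c + midCoeff D W Q k c =
      (4 : ℝ) • diagonal k⁻¹ +
        ((D + W) * diagonal k * (D + W) + (2 : ℝ) • Q + (2 * c) • (D + W)) := by
  simp only [leadCoeff, tailCoeff, midCoeff, add_mul, mul_add]
  module

theorem lead_sub_tail :
    leadCoeff D Q k c - tailCoeff W k c =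
      (D * diagonal k * D - W * diagonal k * W) + Q + c • (D - W) := by
  simp only [leadCoeff, tailCoeff]
  module

variable {D W Q k c}

theorem isSymm_leadCoeff (hD : D.IsSymm) (hQ : Q.IsSymm) : (leadCoeff D Q k c).IsSymm :=
  (((isSymm_diagonal _).add (IsSymm.mul_mul_same hD (isSymm_diagonal _))).add hQ).add (hD.smul c)

theorem isSymm_tailCoeff (hW : W.IsSymm) : (tailCoeff W k c).IsSymm :=
  ((isSymm_diagonal _).add (IsSymm.mul_mul_same hW (isSymm_diagonal _))).add (hW.smul c)

theorem isSymm_midCoeff (hD : D.IsSymm) (hW : W.IsSymm) (hQ : Q.IsSymm) :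
    (midCoeff D W Q k c).IsSymm := by
  refine ((((isSymm_diagonal _).smul _).add ?_).add hQ).add ((hD.add hW).smul c)
  simp only [IsSymm, transpose_add, transpose_mul, hD.eq, hW.eq, diagonal_transpose,
    Matrix.mul_assoc]
  exact add_comm _ _

/-- The functional which annihilates consecutive primal iterates when `v` is a consensus
direction in the kernel of `Q`. -/
def balance (D W : Matrix ι ι ℝ) (k : ι → ℝ) (c : ℝ) (v a b : ι → ℝ) : ℝ :=
  v ⬝ᵥ diagonal k⁻¹ *ᵥ (b - a) + (W *ᵥ v) ⬝ᵥ diagonal k *ᵥ (D *ᵥ b - W *ᵥ a) +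
    c * ((W *ᵥ v) ⬝ᵥ (b - a))

theorem diagonal_form_nonneg (hk : ∀ p, 0 ≤ k p) (v : ι → ℝ) : 0 ≤ v ⬝ᵥ diagonal k *ᵥ v :=
  PosSemidef.form_nonneg (PosSemidef.diagonal hk) v

theorem mul_sq_le_diagonal_form (hk : ∀ p, 0 ≤ k p) (v : ι → ℝ) (p : ι) :
    k p * v p ^ 2 ≤ v ⬝ᵥ diagonal k *ᵥ v := by
  have h : v ⬝ᵥ diagonal k *ᵥ v = ∑ i, k i * v i ^ 2 := by
    simp only [dotProduct, mulVec_diagonal]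
    exact Finset.sum_congr rfl fun i _ => by ring
  rw [h]
  exact Finset.single_le_sum (f := fun i => k i * v i ^ 2)
    (fun i _ => mul_nonneg (hk i) (sq_nonneg _)) (Finset.mem_univ p)

theorem eq_zero_of_diagonal_form_nonpos (hk : ∀ p, 0 < k p) {v : ι → ℝ}
    (h : v ⬝ᵥ diagonal k *ᵥ v ≤ 0) : v = 0 := by
  funext p
  have := (mul_sq_le_diagonal_form (fun p => (hk p).le) v p).trans h
  exact pow_eq_zero_iff two_ne_zero |>.1
    (le_antisymm (nonpos_of_mul_nonpos_right this (hk p)) (sq_nonneg _))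

/-- The primal iterates are two-periodic where the energy is not dissipated. -/
theorem sub_eq_zero_of_balance (hD : D.IsSymm) (hW : W.IsSymm) (hk : ∀ p, 0 < k p)
    (hadd : (D + W).PosSemidef) (hc : 0 ≤ c) {x₀ x₁ x₂ : ι → ℝ}
    (hL : (D - W) *ᵥ (x₂ - x₀) = 0)
    (hS : (D * diagonal k * D - W * diagonal k * W) *ᵥ (x₂ - x₀) = 0)
    (h₀ : balance D W k c (x₂ - x₀) x₀ x₁ = 0) (h₁ : balance D W k c (x₂ - x₀) x₁ x₂ = 0) :
    x₂ - x₀ = 0 := by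
  set d := x₂ - x₀ with hd
  have hDW : D *ᵥ d = W *ᵥ d := by rwa [sub_mulVec, sub_eq_zero] at hL
  have horth : ∀ y, (W *ᵥ d) ⬝ᵥ diagonal k *ᵥ ((D - W) *ᵥ y) = 0 := by
    intro y
    have h := congrArg (fun u => y ⬝ᵥ u) hS
    simp only [sub_mulVec, ← mulVec_mulVec, dotProduct_sub, dotProduct_zero, hDW] at h
    rw [dotProduct_mulVec_comm (isSymm_diagonal _), mulVec_dotProduct_comm (hD.sub hW),
      sub_mulVec, dotProduct_sub, h]
  have hWd : 0 ≤ (W *ᵥ d) ⬝ᵥ d := by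
    have := PosSemidef.form_nonneg hadd d
    rw [add_mulVec, hDW, dotProduct_add, dotProduct_comm] at this
    linarith
  refine eq_zero_of_diagonal_form_nonpos (k := k⁻¹) (fun p => inv_pos.2 (hk p)) ?_
  have hWW := diagonal_form_nonneg (fun p => (hk p).le) (W *ᵥ d)
  have hsum := horth (x₂ + x₁)
  simp only [balance, mulVec_sub, mulVec_add, sub_mulVec, dotProduct_sub, dotProduct_add, hd,
    sub_dotProduct] at h₀ h₁ hsum hWd hWW ⊢
  nlinarith [mul_nonneg hc hWd]

/-- Windows of four consecutive states compatible with the primal dynamics. -/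
def windows (D W Q : Matrix ι ι ℝ) (k : ι → ℝ) (c : ℝ) : Submodule ℝ (Fin 4 → ι → ℝ) where
  carrier := {w | (∀ i : Fin 2, leadCoeff D Q k c *ᵥ w (i.natAdd 2) -
      midCoeff D W Q k c *ᵥ w (i.castSucc.succ) +
      tailCoeff W k c *ᵥ w (i.castAdd 2) = 0) ∧
    ∀ v, (D - W) *ᵥ v = 0 → Q *ᵥ v = 0 →
      ∀ i : Fin 3, balance D W k c v (w i.castSucc) (w i.succ) = 0}
  zero_mem' := by simp [balance]
  add_mem' := by
    rintro w u ⟨hw, hw'⟩ ⟨hu, hu'⟩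
    refine ⟨fun i => ?_, fun v hL hQ i => ?_⟩
    · have h := congrArg₂ (· + ·) (hw i) (hu i)
      simp only [Pi.add_apply, mulVec_add, add_zero] at h ⊢
      rw [← h]
      abel
    · have h1 := hw' v hL hQ i
      have h2 := hu' v hL hQ i
      simp only [balance, Pi.add_apply, mulVec_add, mulVec_sub, dotProduct_add,
        dotProduct_sub] at h1 h2 ⊢
      linarith
  smul_mem' := by
    rintro a w ⟨hw, hw'⟩
    refine ⟨fun i => ?_, fun v hL hQ i => ?_⟩
    · have h := congrArg (a • ·) (hw i)
      simpa only [Pi.smul_apply, mulVec_smul, smul_zero, smul_add, smul_sub] using h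
    · have h := congrArg (a * ·) (hw' v hL hQ i)
      simp only [balance, Pi.smul_apply, mulVec_smul, mulVec_sub, dotProduct_smul,
        dotProduct_sub, smul_eq_mul, mul_zero] at h ⊢
      linarith

section Iteration

variable {q : ι → ℝ} {x z : ℕ → ι → ℝ}

theorem residual_eq_zero (hk : ∀ p, 0 < k p)
    (hx : ∀ t, x (t + 1) = x t - diagonal k *ᵥ (Q *ᵥ x (t + 1) - q)
      - diagonal k *ᵥ (D *ᵥ z (t + 1) - W *ᵥ z t)
      - c • diagonal k *ᵥ (D *ᵥ x (t + 1) - W *ᵥ x t)) (t : ℕ) :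
    diagonal k⁻¹ *ᵥ (x (t + 1) - x t) + (Q *ᵥ x (t + 1) - q) + (D *ᵥ z (t + 1) - W *ᵥ z t) +
      c • (D *ᵥ x (t + 1) - W *ᵥ x t) = 0 := by
  funext p
  have h := congrFun (hx t) p
  have hkp := (hk p).ne'
  simp only [Pi.add_apply, Pi.sub_apply, Pi.smul_apply, mulVec_diagonal, smul_eq_mul,
    Pi.inv_apply, Pi.zero_apply] at h ⊢
  rw [h]
  field_simp
  ring

theorem second_order (hk : ∀ p, 0 < k p)
    (hx : ∀ t, x (t + 1) = x t - diagonal k *ᵥ (Q *ᵥ x (t + 1) - q)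
      - diagonal k *ᵥ (D *ᵥ z (t + 1) - W *ᵥ z t)
      - c • diagonal k *ᵥ (D *ᵥ x (t + 1) - W *ᵥ x t))
    (hz : ∀ t, z (t + 1) = z t + diagonal k *ᵥ (D *ᵥ x (t + 1) - W *ᵥ x t)) (t : ℕ) :
    leadCoeff D Q k c *ᵥ x (t + 2) - midCoeff D W Q k c *ᵥ x (t + 1) +
      tailCoeff W k c *ᵥ x t = 0 := by
  have h1 := residual_eq_zero hk hx (t + 1)
  have h0 := residual_eq_zero hk hx t
  rw [hz (t + 1)] at h1
  have e : D *ᵥ z (t + 1) = D *ᵥ z t + D *ᵥ diagonal k *ᵥ (D *ᵥ x (t + 1) - W *ᵥ x t) := by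
    rw [← mulVec_add, ← hz]
  have e' : W *ᵥ z (t + 1) = W *ᵥ z t + W *ᵥ diagonal k *ᵥ (D *ᵥ x (t + 1) - W *ᵥ x t) := by
    rw [← mulVec_add, ← hz]
  have h := (congrArg₂ (· - ·) h1 h0).trans (sub_zero 0)
  simp only [mulVec_add] at h
  rw [e'] at h
  simp only [leadCoeff, midCoeff, tailCoeff, add_mulVec, smul_mulVec, ← mulVec_mulVec,
    mulVec_sub, show t + 1 + 1 = t + 2 from rfl] at h ⊢
  rw [← h]
  module

theorem balance_eq (hD : D.IsSymm) (hW : W.IsSymm) (hk : ∀ p, 0 < k p)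
    (hx : ∀ t, x (t + 1) = x t - diagonal k *ᵥ (Q *ᵥ x (t + 1) - q)
      - diagonal k *ᵥ (D *ᵥ z (t + 1) - W *ᵥ z t)
      - c • diagonal k *ᵥ (D *ᵥ x (t + 1) - W *ᵥ x t))
    (hz : ∀ t, z (t + 1) = z t + diagonal k *ᵥ (D *ᵥ x (t + 1) - W *ᵥ x t))
    {v : ι → ℝ} (hv : (D - W) *ᵥ v = 0) (t : ℕ) :
    balance D W k c v (x t) (x (t + 1)) + v ⬝ᵥ (Q *ᵥ x (t + 1) - q) = 0 := by
  have hDW : D *ᵥ v = W *ᵥ v := by rwa [sub_mulVec, sub_eq_zero] at hv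
  have hcons : ∀ a b, v ⬝ᵥ (D *ᵥ b - W *ᵥ a) = (W *ᵥ v) ⬝ᵥ (b - a) := fun a b => by
    rw [dotProduct_sub, ← mulVec_dotProduct_comm hD, ← mulVec_dotProduct_comm hW, hDW,
      dotProduct_sub]
  have h := congrArg (fun u => v ⬝ᵥ u) (residual_eq_zero hk hx t)
  simp only [dotProduct_add, dotProduct_smul, hcons, dotProduct_zero, smul_eq_mul] at h
  rw [show z (t + 1) - z t = diagonal k *ᵥ (D *ᵥ x (t + 1) - W *ᵥ x t) by
    rw [hz t, add_sub_cancel_left]] at h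
  rw [balance]
  linarith

/-- The primal iterates converge geometrically to a consensus vector satisfying the normal
equations in every consensus direction. -/
theorem exists_geometric_limit (hD : D.IsSymm) (hW : W.IsSymm) (hk : ∀ p, 0 < k p)
    (hc : 0 ≤ c) (hQ : Q.PosSemidef) (hsub : (D - W).PosSemidef) (hadd : (D + W).PosSemidef)
    (hS : (D * diagonal k * D - W * diagonal k * W).PosSemidef)
    (hcons : ∀ u, Q *ᵥ u = 0 → (D * diagonal k * D - W * diagonal k * W) *ᵥ u = 0 →
      c • ((D - W) *ᵥ u) = 0 → (D - W) *ᵥ u = 0)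
    (hq : ∀ v, Q *ᵥ v = 0 → v ⬝ᵥ q = 0)
    (hx : ∀ t, x (t + 1) = x t - diagonal k *ᵥ (Q *ᵥ x (t + 1) - q)
      - diagonal k *ᵥ (D *ᵥ z (t + 1) - W *ᵥ z t)
      - c • diagonal k *ᵥ (D *ᵥ x (t + 1) - W *ᵥ x t))
    (hz : ∀ t, z (t + 1) = z t + diagonal k *ᵥ (D *ᵥ x (t + 1) - W *ᵥ x t)) :
    ∃ y : ι → ℝ, ∃ C r : ℝ, 0 ≤ C ∧ 0 ≤ r ∧ r < 1 ∧ (∀ t, ‖x t - y‖ ≤ C * r ^ t) ∧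
      (D - W) *ᵥ y = 0 ∧ ∀ v, (D - W) *ᵥ v = 0 → v ⬝ᵥ (Q *ᵥ y - q) = 0 := by
  have hQs := PosSemidef.isSymm hQ
  set P := leadCoeff D Q k c
  set N := tailCoeff W k c
  set B := midCoeff D W Q k c
  have hP : P.IsSymm := isSymm_leadCoeff hD hQs
  have hN : N.IsSymm := isSymm_tailCoeff hW
  have hB : B.IsSymm := isSymm_midCoeff hD hW hQs
  have hk0 : ∀ p, 0 ≤ k p := fun p => (hk p).le
  have hkinv : ∀ p, 0 ≤ k⁻¹ p := fun p => inv_nonneg.2 (hk0 p)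
  have form_sub : ∀ v, v ⬝ᵥ (P + N - B) *ᵥ v =
      ((D - W) *ᵥ v) ⬝ᵥ diagonal k *ᵥ ((D - W) *ᵥ v) := fun v => by
    rw [lead_add_tail_sub_mid, form_mul_mul_same (hD.sub hW)]
  have form_add : ∀ v, 4 * (v ⬝ᵥ diagonal k⁻¹ *ᵥ v) ≤ v ⬝ᵥ (P + N + B) *ᵥ v := fun v => by
    have h1 := PosSemidef.form_nonneg hQ v
    have h2 := mul_nonneg hc (PosSemidef.form_nonneg hadd v)
    have h3 := diagonal_form_nonneg hk0 ((D + W) *ᵥ v)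
    rw [lead_add_tail_add_mid, add_mulVec, add_mulVec, add_mulVec, dotProduct_add, dotProduct_add,
      dotProduct_add, form_mul_mul_same (hD.add hW), smul_mulVec, smul_mulVec, smul_mulVec,
      dotProduct_smul, dotProduct_smul, dotProduct_smul, smul_eq_mul, smul_eq_mul, smul_eq_mul]
    linarith
  have hsub0 : ∀ v, 0 ≤ v ⬝ᵥ (P + N - B) *ᵥ v := fun v => by
    rw [form_sub]; exact diagonal_form_nonneg hk0 _
  have hadd0 : ∀ v, 0 ≤ v ⬝ᵥ (P + N + B) *ᵥ v := fun v =>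
    le_trans (mul_nonneg (by norm_num) (diagonal_form_nonneg hkinv v)) (form_add v)
  have hpsd : (P - N).PosSemidef := by
    rw [lead_sub_tail]
    exact (hS.add hQ).add (hsub.smul hc)
  have hker : ∀ u, u ⬝ᵥ (P - N) *ᵥ u = 0 → Q *ᵥ u = 0 ∧
      (D * diagonal k * D - W * diagonal k * W) *ᵥ u = 0 ∧ (D - W) *ᵥ u = 0 := by
    intro u hu
    have h1 := PosSemidef.form_nonneg hQ u
    have h2 := PosSemidef.form_nonneg hS u
    have h3 := PosSemidef.form_nonneg (hsub.smul hc) u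
    rw [lead_sub_tail, add_mulVec, add_mulVec, dotProduct_add, dotProduct_add] at hu
    have hQu := PosSemidef.form_eq_zero hQ (v := u) (by linarith)
    have hSu := PosSemidef.form_eq_zero hS (v := u) (by linarith)
    have hLu := PosSemidef.form_eq_zero (hsub.smul hc) (v := u) (by linarith)
    rw [smul_mulVec] at hLu
    exact ⟨hQu, hSu, hcons u hQu hSu hLu⟩
  obtain ⟨C, ρ, hC, hρ0, hρ1, henergy⟩ := energy_geometric hP hN hB hsub0 hadd0
    (PosSemidef.form_nonneg hpsd) (windows D W Q k c) (fun w hw => hw.1 0) (fun w hw => hw.1 1)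
    (fun w hw h => by
      obtain ⟨hQu, hSu, hLu⟩ := hker _ h
      exact sub_eq_zero.1 (sub_eq_zero_of_balance hD hW hk hadd hc hLu hSu
        (hw.2 _ hLu hQu 0) (hw.2 _ hLu hQu 1)))
    (fun w hw h => by
      obtain ⟨hQu, hSu, hLu⟩ := hker _ h
      exact sub_eq_zero.1 (sub_eq_zero_of_balance hD hW hk hadd hc hLu hSu
        (hw.2 _ hLu hQu 1) (hw.2 _ hLu hQu 2)))
    x (fun t => by
      refine ⟨fun i => ?_, fun v hL hQv i => ?_⟩
      · fin_cases i
        · exact second_order hk hx hz t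
        · exact second_order hk hx hz (t + 1)
      · have hb : ∀ s, balance D W k c v (x s) (x (s + 1)) = 0 := fun s => by
          have h := balance_eq hD hW hk hx hz hL s
          rwa [dotProduct_sub, hq v hQv, ← mulVec_dotProduct_comm hQs, hQv, zero_dotProduct,
            sub_zero, add_zero] at h
        fin_cases i
        · exact hb t
        · exact hb (t + 1)
        · exact hb (t + 2))
  set M : ℝ := ∑ p, k p
  have hM0 : 0 ≤ M := Finset.sum_nonneg fun p _ => hk0 p
  have hstep : ∀ t, dist (x t) (x (t + 1)) ≤ √(M * C) * √ρ ^ t := by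
    intro t
    rw [dist_comm, dist_eq_norm, pi_norm_le_iff_of_nonneg (by positivity)]
    intro p
    have hkM : k p ≤ M := Finset.single_le_sum (fun p _ => hk0 p) (Finset.mem_univ p)
    have h1 := mul_sq_le_diagonal_form hkinv (x (t + 1) - x t) p
    have h2 := two_mul_energy (P := P) (N := N) hB (x t) (x (t + 1))
    have h3 := hsub0 (x (t + 1) + x t)
    have h4 := form_add (x (t + 1) - x t)
    have h5 := henergy t
    have hCρ : 0 ≤ C * ρ ^ t := by positivity
    have h6 : (k p)⁻¹ * (x (t + 1) - x t) p ^ 2 ≤ C * ρ ^ t := by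
      rw [Pi.inv_apply] at h1
      nlinarith [sq_nonneg ((x (t + 1) - x t) p), inv_nonneg.2 (hk0 p)]
    rw [inv_mul_le_iff₀ (hk p)] at h6
    rw [Real.norm_eq_abs]
    refine abs_le_of_sq_le_sq ?_ (by positivity)
    rw [mul_pow, ← pow_mul, mul_comm t 2, pow_mul, Real.sq_sqrt hρ0, Real.sq_sqrt (by positivity),
      mul_assoc]
    exact h6.trans (mul_le_mul_of_nonneg_right hkM hCρ)
  have hr : √ρ < 1 := by rwa [Real.sqrt_lt' one_pos, one_pow]
  obtain ⟨y, hy⟩ := cauchySeq_tendsto_of_complete (cauchySeq_of_le_geometric _ _ hr hstep)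
  have hy1 := hy.comp (Filter.tendsto_add_atTop_nat 1)
  have hLy : (D - W) *ᵥ y = 0 := by
    have hcont : Continuous fun w : (ι → ℝ) × (ι → ℝ) => energy P N B w.1 w.2 := by
      unfold energy
      fun_prop
    have hlim := (hcont.tendsto (y, y)).comp (hy.prodMk_nhds hy1)
    have hzero : Filter.Tendsto (fun t => C * ρ ^ t) Filter.atTop (nhds 0) := by
      simpa using (tendsto_pow_atTop_nhds_zero_of_lt_one hρ0 hρ1).const_mul C
    have hle : energy P N B y y ≤ 0 := le_of_tendsto_of_tendsto' hlim hzero henergy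
    have h2 := two_mul_energy (P := P) (N := N) hB y y
    have h3 := hadd0 (y - y)
    rw [form_sub] at h2
    have h4 := eq_zero_of_diagonal_form_nonpos hk (v := (D - W) *ᵥ (y + y)) (by linarith)
    rw [mulVec_add, ← two_smul ℝ] at h4
    exact (smul_eq_zero.1 h4).resolve_left two_ne_zero
  refine ⟨y, √(M * C) / (1 - √ρ), √ρ, div_nonneg (Real.sqrt_nonneg _) (by linarith),
    Real.sqrt_nonneg _, hr, fun t => ?_, hLy, fun v hv => ?_⟩
  · rw [← dist_eq_norm, div_mul_eq_mul_div]
    exact dist_le_of_le_geometric_of_tendsto _ _ hr hstep hy t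
  · have hcont : Continuous fun w : (ι → ℝ) × (ι → ℝ) =>
        balance D W k c v w.1 w.2 + v ⬝ᵥ (Q *ᵥ w.2 - q) := by
      unfold balance
      fun_prop
    have hlim := (hcont.tendsto (y, y)).comp (hy.prodMk_nhds hy1)
    have hlim0 := tendsto_nhds_unique (hlim.congr fun t => balance_eq hD hW hk hx hz hv t)
      tendsto_const_nhds
    have hbal : balance D W k c v y y = 0 := by
      rw [balance, ← sub_mulVec, hLy]
      simp
    change balance D W k c v y y + v ⬝ᵥ (Q *ᵥ y - q) = 0 at hlim0
    rwa [hbal, zero_add] at hlim0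

end Iteration

end Recursion

end EnergyMethod

theorem bar_mul (n : ℕ) {m : ℕ} (M N : Matrix (Fin m) (Fin m) ℝ) :
    bar n (M * N) = bar n M * bar n N := by
  rw [bar, bar, bar, ← mul_kronecker_mul, one_mul]

theorem bar_sub (n : ℕ) {m : ℕ} (M N : Matrix (Fin m) (Fin m) ℝ) :
    bar n (M - N) = bar n M - bar n N :=
  ext fun _ _ => sub_mul _ _ _

theorem bar_add (n : ℕ) {m : ℕ} (M N : Matrix (Fin m) (Fin m) ℝ) :
    bar n (M + N) = bar n M + bar n N :=
  add_kronecker _ _ _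

theorem bar_diagonal (n : ℕ) {m : ℕ} (d : Fin m → ℝ) :
    bar n (diagonal d) = diagonal fun p => d p.1 := by
  rw [bar, ← diagonal_one, diagonal_kronecker_diagonal]
  simp

theorem bar_isSymm (n : ℕ) {m : ℕ} {M : Matrix (Fin m) (Fin m) ℝ} (hM : M.IsSymm) :
    (bar n M).IsSymm := by
  rw [IsSymm, bar, ← kroneckerMap_transpose, hM.eq, transpose_one]

theorem bar_posSemidef (n : ℕ) {m : ℕ} {M : Matrix (Fin m) (Fin m) ℝ} (hM : M.PosSemidef) :
    (bar n M).PosSemidef :=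
  hM.kronecker PosSemidef.one

theorem bar_mulVec_apply (n : ℕ) {m : ℕ} (M : Matrix (Fin m) (Fin m) ℝ)
    (v : Fin m × Fin n → ℝ) (i : Fin m) (j : Fin n) :
    (bar n M *ᵥ v) (i, j) = (M *ᵥ fun l => v (l, j)) i := by
  simp only [bar, mulVec, dotProduct, Fintype.sum_prod_type, kroneckerMap_apply, one_apply,
    mul_ite, mul_one, mul_zero, ite_mul, zero_mul, Finset.sum_ite_eq, Finset.mem_univ, if_true]

theorem blockDiag_mulVec_apply {m n : ℕ} (ni : Fin m → ℕ)
    (A : ∀ i, Matrix (Fin (ni i)) (Fin n) ℝ) (v : Fin m × Fin n → ℝ) (i : Fin m)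
    (a : Fin (ni i)) :
    (blockDiag ni A *ᵥ v) ⟨i, a⟩ = (A i *ᵥ fun j => v (i, j)) a := by
  simp only [_root_.blockDiag, mulVec, dotProduct, Fintype.sum_prod_type, ite_mul, zero_mul]
  rw [Finset.sum_eq_single i]
  · simp
  · intro l _ hl
    simp [hl.symm]
  · simp

theorem isSymm_rowSumDiag {m : ℕ} (W : Matrix (Fin m) (Fin m) ℝ) : (rowSumDiag W).IsSymm :=
  isSymm_diagonal _

theorem form_rowSumDiag_add_smul {m : ℕ} {W : Matrix (Fin m) (Fin m) ℝ} (hW : W.IsSymm)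
    {s : ℝ} (hs : s ^ 2 = 1) (v : Fin m → ℝ) :
    v ⬝ᵥ (rowSumDiag W + s • W) *ᵥ v = (1 / 2) * ∑ i, ∑ j, W i j * (v i + s * v j) ^ 2 := by
  have h1 : v ⬝ᵥ rowSumDiag W *ᵥ v = ∑ i, ∑ j, W i j * v i ^ 2 := by
    simp only [rowSumDiag, dotProduct, mulVec_diagonal]
    refine Finset.sum_congr rfl fun i _ => ?_
    rw [← Finset.sum_mul]
    ring
  have h2 : ∑ i, ∑ j, W i j * v i ^ 2 = ∑ i, ∑ j, W i j * v j ^ 2 := by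
    rw [Finset.sum_comm]
    exact Finset.sum_congr rfl fun i _ => Finset.sum_congr rfl fun j _ => by rw [hW.apply]
  have h3 : v ⬝ᵥ W *ᵥ v = ∑ i, ∑ j, W i j * (v i * v j) := by
    simp only [dotProduct, mulVec, Finset.mul_sum]
    exact Finset.sum_congr rfl fun i _ => Finset.sum_congr rfl fun j _ => by ring
  have h4 : ∀ i j, W i j * (v i + s * v j) ^ 2 =
      W i j * v i ^ 2 + (2 * s) * (W i j * (v i * v j)) + W i j * v j ^ 2 := fun i j => by
    linear_combination W i j * v j ^ 2 * hs
  simp only [h4, Finset.sum_add_distrib, ← Finset.mul_sum]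
  rw [add_mulVec, smul_mulVec, dotProduct_add, dotProduct_smul, smul_eq_mul, ← h2, ← h1, ← h3]
  ring

theorem posSemidef_rowSumDiag_add_smul {m : ℕ} {W : Matrix (Fin m) (Fin m) ℝ} (hW : W.IsSymm)
    (hWnn : ∀ i j, 0 ≤ W i j) {s : ℝ} (hs : s ^ 2 = 1) :
    (rowSumDiag W + s • W).PosSemidef := by
  refine .of_dotProduct_mulVec_nonneg ?_ fun v => ?_
  · rw [IsHermitian, conjTranspose_eq_transpose_of_trivial]
    exact (isSymm_rowSumDiag W).add (hW.smul s)
  · rw [star_trivial, form_rowSumDiag_add_smul hW hs]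
    exact mul_nonneg (by norm_num) (Finset.sum_nonneg fun i _ => Finset.sum_nonneg fun j _ =>
      mul_nonneg (hWnn i j) (sq_nonneg _))

/-- A consensus vector satisfying the stacked normal equations is a least squares solution. -/
theorem least_squares_of_normal_equations {m n : ℕ} {ni : Fin m → ℕ}
    (A : ∀ i, Matrix (Fin (ni i)) (Fin n) ℝ) (b : ∀ i, Fin (ni i) → ℝ) (w : Fin n → ℝ)
    (h : ∀ y : Fin n → ℝ, ∑ i, (A i *ᵥ y) ⬝ᵥ (A i *ᵥ w - b i) = 0) (y : Fin n → ℝ) :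
    (1 / 2) * ∑ i, ((A i *ᵥ w - b i) ⬝ᵥ (A i *ᵥ w - b i)) ≤
      (1 / 2) * ∑ i, ((A i *ᵥ y - b i) ⬝ᵥ (A i *ᵥ y - b i)) := by
  have hexp : ∑ i, ((A i *ᵥ y - b i) ⬝ᵥ (A i *ᵥ y - b i)) =
      ∑ i, ((A i *ᵥ w - b i) ⬝ᵥ (A i *ᵥ w - b i)) +
        2 * ∑ i, (A i *ᵥ (y - w)) ⬝ᵥ (A i *ᵥ w - b i) +
        ∑ i, (A i *ᵥ (y - w)) ⬝ᵥ (A i *ᵥ (y - w)) := by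
    rw [Finset.mul_sum, ← Finset.sum_add_distrib, ← Finset.sum_add_distrib]
    refine Finset.sum_congr rfl fun i _ => ?_
    have e : A i *ᵥ y - b i = A i *ᵥ (y - w) + (A i *ᵥ w - b i) := by
      rw [mulVec_sub]; abel
    rw [e, dotProduct_add, add_dotProduct, add_dotProduct,
      dotProduct_comm (A i *ᵥ w - b i) (A i *ᵥ (y - w))]
    ring
  have hnn : 0 ≤ ∑ i, (A i *ᵥ (y - w)) ⬝ᵥ (A i *ᵥ (y - w)) :=
    Finset.sum_nonneg fun i _ => dotProduct_self_star_nonneg (A i *ᵥ (y - w))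
  rw [hexp, h]
  linarith

theorem stmt0 (m n : ℕ) (ni : Fin m → ℕ)
    (W : Matrix (Fin m) (Fin m) ℝ) (κ : Fin m → ℝ)
    (A : ∀ i, Matrix (Fin (ni i)) (Fin n) ℝ) (b : ∀ i, Fin (ni i) → ℝ)
    (c cbar : ℝ)
    (hWsymm : W.IsSymm)
    (hWnn : ∀ i j, 0 ≤ W i j)
    (hWdiag : ∀ i, 0 < W i i)
    (hker : ∀ v : Fin m → ℝ,
      (rowSumDiag W - W).mulVec v = 0 ↔ ∃ a : ℝ, v = fun _ => a)
    (hκ : ∀ i, 0 < κ i) (hcbar : 0 < cbar) (hc : 0 ≤ c)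
    (hpsd : (rowSumDiag W * Matrix.diagonal κ * rowSumDiag W
        - W * Matrix.diagonal κ * W).PosSemidef)
    (hcpos : (∃ u : Fin m × Fin n → ℝ, u ≠ 0 ∧
        (blockDiag ni A).mulVec u = 0 ∧
        (bar n (rowSumDiag W * Matrix.diagonal κ * rowSumDiag W
          - W * Matrix.diagonal κ * W)).mulVec u = 0 ∧
        (bar n (rowSumDiag W - W)).mulVec u ≠ 0) → 0 < c)
    (x z : ℕ → Fin m × Fin n → ℝ)
    (hx : ∀ t, x (t + 1) = x t
        - cbar • (bar n (Matrix.diagonal κ)).mulVec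
            (((blockDiag ni A)ᵀ * blockDiag ni A).mulVec (x (t + 1))
              - (blockDiag ni A)ᵀ.mulVec (bvec b))
        - (bar n (Matrix.diagonal κ)).mulVec
            ((bar n (rowSumDiag W)).mulVec (z (t + 1)) - (bar n W).mulVec (z t))
        - c • (bar n (Matrix.diagonal κ)).mulVec
            ((bar n (rowSumDiag W)).mulVec (x (t + 1)) - (bar n W).mulVec (x t)))
    (hz : ∀ t, z (t + 1) = z t + (bar n (Matrix.diagonal κ)).mulVec
        ((bar n (rowSumDiag W)).mulVec (x (t + 1)) - (bar n W).mulVec (x t))) :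
    ∃ xstar : Fin n → ℝ,
      (∀ y : Fin n → ℝ,
        (1 / 2) * ∑ i, (((A i).mulVec xstar - b i) ⬝ᵥ ((A i).mulVec xstar - b i)) ≤
        (1 / 2) * ∑ i, (((A i).mulVec y - b i) ⬝ᵥ ((A i).mulVec y - b i))) ∧
      ∃ C r : ℝ, 0 ≤ C ∧ 0 ≤ r ∧ r < 1 ∧
        ∀ t, ‖x t - (fun p : Fin m × Fin n => xstar p.2)‖ ≤ C * r ^ t := by
  set D := bar n (rowSumDiag W)
  set Wb := bar n W
  set k : Fin m × Fin n → ℝ := fun p => κ p.1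
  set Ab := blockDiag ni A
  have hK : bar n (diagonal κ) = diagonal k := bar_diagonal n κ
  have hL : bar n (rowSumDiag W - W) = D - Wb := bar_sub n _ _
  have hS : bar n (rowSumDiag W * diagonal κ * rowSumDiag W - W * diagonal κ * W) =
      D * diagonal k * D - Wb * diagonal k * Wb := by
    rw [bar_sub, bar_mul, bar_mul, bar_mul, bar_mul, hK]
  have hsub : (D - Wb).PosSemidef := by
    have h := posSemidef_rowSumDiag_add_smul hWsymm hWnn (s := -1) (by norm_num)
    rw [neg_one_smul, ← sub_eq_add_neg] at h
    exact hL ▸ bar_posSemidef n h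
  have hadd : (D + Wb).PosSemidef := by
    have h := posSemidef_rowSumDiag_add_smul hWsymm hWnn (s := 1) (by norm_num)
    rw [one_smul] at h
    exact bar_add n (rowSumDiag W) W ▸ bar_posSemidef n h
  have hQ : (cbar • (Abᵀ * Ab)).PosSemidef := by
    have h := posSemidef_conjTranspose_mul_self Ab
    rw [conjTranspose_eq_transpose_of_trivial] at h
    exact h.smul hcbar.le
  have hQker : ∀ u, (cbar • (Abᵀ * Ab)) *ᵥ u = 0 → Ab *ᵥ u = 0 := by
    intro u hu
    rw [smul_mulVec] at hu
    have h := (smul_eq_zero.1 hu).resolve_left hcbar.ne'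
    have h' := congrArg (fun y => u ⬝ᵥ y) h
    simp only [← mulVec_mulVec, dotProduct_zero] at h'
    rw [dotProduct_mulVec, vecMul_transpose] at h'
    exact dotProduct_self_eq_zero.1 h'
  rw [hS, hL] at hcpos
  rw [hK] at hx hz
  obtain ⟨y, C, r, hC, hr0, hr1, hlim, hLy, hnormal⟩ :=
    exists_geometric_limit (D := D) (W := Wb) (Q := cbar • (Abᵀ * Ab)) (k := k) (c := c)
      (q := cbar • (Abᵀ *ᵥ bvec b)) (x := x) (z := z)
      (bar_isSymm n (isSymm_rowSumDiag W)) (bar_isSymm n hWsymm) (fun p => hκ p.1) hc hQ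
      hsub hadd (hS ▸ bar_posSemidef n hpsd)
      (fun u hQu hSu hcu => by
        by_contra hLu
        have hu : u ≠ 0 := fun h => hLu (by rw [h, mulVec_zero])
        exact hLu ((smul_eq_zero.1 hcu).resolve_left
          (hcpos ⟨u, hu, hQker u hQu, hSu, hLu⟩).ne'))
      (fun v hv => by
        rw [dotProduct_smul, dotProduct_mulVec, vecMul_transpose, hQker v hv, zero_dotProduct,
          smul_zero])
      (fun t => by
        rw [smul_mulVec, ← smul_sub, mulVec_smul]
        exact hx t)
      hz
  have hcols : ∀ j : Fin n, ∃ a : ℝ, (fun i => y (i, j)) = fun _ => a := by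
    intro j
    rw [← hker]
    funext i
    rw [← bar_mulVec_apply, hL, hLy]
    rfl
  choose w hw using hcols
  have hyw : y = fun p => w p.2 := funext fun p => congrFun (hw p.2) p.1
  refine ⟨w, least_squares_of_normal_equations A b w fun u => ?_, C, r, hC, hr0, hr1,
    fun t => hyw ▸ hlim t⟩
  have hu : (D - Wb) *ᵥ (fun p : Fin m × Fin n => u p.2) = 0 := by
    funext p
    rw [← hL, show p = (p.1, p.2) from rfl, bar_mulVec_apply, (hker _).2 ⟨u p.2, rfl⟩]
    rfl
  have h := hnormal _ hu
  rw [smul_mulVec, ← smul_sub, dotProduct_smul, smul_eq_mul, ← mulVec_mulVec, ← mulVec_sub,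
    dotProduct_mulVec, vecMul_transpose] at h
  have h' := (mul_eq_zero.1 h).resolve_left hcbar.ne'
  simp only [dotProduct, Fintype.sum_sigma, Pi.sub_apply, hyw, Ab, blockDiag_mulVec_apply] at h'
  exact h'
end
end

section
/- Let K̄ and D̄ be mn×mn diagonal matrices with positive diagonal entries, let Ā be any real p×mn matrix, and let c ≥ 0, c̄ ≥ 0. Then the 2mn×2mn block matrix E = [[I_{mn} + c̄ K̄ Ā'Ā + c K̄ D̄, K̄ D̄], [−K̄ D̄, I_{mn}]] is invertible. -/
open Matrix

noncomputable section

theorem stmt2 (m n p : ℕ) (κ d : Fin (m * n) → ℝ)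
    (hκ : ∀ i, 0 < κ i) (hd : ∀ i, 0 < d i)
    (Abar : Matrix (Fin p) (Fin (m * n)) ℝ) (c cbar : ℝ)
    (hc : 0 ≤ c) (hcbar : 0 ≤ cbar) :
    IsUnit (Matrix.fromBlocks
      (1 + cbar • (Matrix.diagonal κ * (Abarᵀ * Abar))
         + c • (Matrix.diagonal κ * Matrix.diagonal d))
      (Matrix.diagonal κ * Matrix.diagonal d)
      (-(Matrix.diagonal κ * Matrix.diagonal d))
      (1 : Matrix (Fin (m * n)) (Fin (m * n)) ℝ)) := by
  set w : Fin (m * n) → ℝ := fun i => (κ i)⁻¹ + c * d i + d i * κ i * d i with hw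
  have hdiag : (diagonal w).PosDef := by
    refine PosDef.diagonal fun i => ?_
    have := hκ i
    have := hd i
    positivity
  have hgram : (cbar • (Abarᵀ * Abar)).PosSemidef := by
    have h := posSemidef_conjTranspose_mul_self Abar
    rw [conjTranspose_eq_transpose_of_trivial] at h
    exact h.smul hcbar
  have hunit : IsUnit (diagonal κ * (diagonal w + cbar • (Abarᵀ * Abar))) := by
    refine IsUnit.mul (PosDef.diagonal hκ).isUnit (hdiag.add_posSemidef hgram).isUnit
  have hκw : diagonal κ * diagonal w
      = 1 + c • (diagonal κ * diagonal d)
        + diagonal κ * diagonal d * (diagonal κ * diagonal d) := by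
    simp only [diagonal_mul_diagonal, ← diagonal_one, ← diagonal_smul, diagonal_add]
    congr 1
    funext i
    have := (hκ i).ne'
    simp only [hw, Pi.smul_apply, smul_eq_mul]
    field_simp
  rw [isUnit_iff_isUnit_det, det_fromBlocks_one₂₂, ← isUnit_iff_isUnit_det]
  convert hunit using 1
  rw [mul_add, hκw, mul_neg, sub_neg_eq_add, Matrix.mul_smul]
  abel
end
end

section
/- Suppose W is an m×m real symmetric matrix with nonnegative entries and positive diagonal entries, κ_1,…,κ_m > 0, c ≥ 0, c̄ > 0, and E is invertible. Then the eigenvalue 1 of Q = E⁻¹ F is semisimple: the kernel of (Q − I)² equals the kernel of (Q − I), i.e., the algebraic multiplicity of the eigenvalue 1 equals its geometric multiplicity. -/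
open Matrix
open scoped Kronecker

noncomputable section

/-- The block matrix `E`. -/
def Emat {m n : ℕ} (ni : Fin m → ℕ) (A : ∀ i, Matrix (Fin (ni i)) (Fin n) ℝ)
    (W : Matrix (Fin m) (Fin m) ℝ) (κ : Fin m → ℝ) (c cbar : ℝ) :
    Matrix ((Fin m × Fin n) ⊕ (Fin m × Fin n)) ((Fin m × Fin n) ⊕ (Fin m × Fin n)) ℝ :=
  Matrix.fromBlocks
    (1 + cbar • (bar n (Matrix.diagonal κ) * ((blockDiag ni A)ᵀ * blockDiag ni A))
       + c • (bar n (Matrix.diagonal κ) * bar n (rowSumDiag W)))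
    (bar n (Matrix.diagonal κ) * bar n (rowSumDiag W))
    (-(bar n (Matrix.diagonal κ) * bar n (rowSumDiag W)))
    1

/-- The block matrix `F`. -/
def Fmat (n : ℕ) {m : ℕ} (W : Matrix (Fin m) (Fin m) ℝ) (κ : Fin m → ℝ) (c : ℝ) :
    Matrix ((Fin m × Fin n) ⊕ (Fin m × Fin n)) ((Fin m × Fin n) ⊕ (Fin m × Fin n)) ℝ :=
  Matrix.fromBlocks
    (1 + c • (bar n (Matrix.diagonal κ) * bar n W))
    (bar n (Matrix.diagonal κ) * bar n W)
    (-(bar n (Matrix.diagonal κ) * bar n W))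
    1

/-- A vector `(x, y)` of the kernel of `E - F` whose image under `E` lies in the range of `E - F`
vanishes. Here `J` is the inverse of `K`, `B` stands for `Ā`, and the hypotheses are the block rows
of the two conditions after multiplication by `J`. -/
theorem eq_zero_of_block_rows {ι μ : Type*} [Fintype ι] [Fintype μ] {J D W : Matrix ι ι ℝ}
    (B : Matrix μ ι ℝ) {c cbar : ℝ} (hc : 0 ≤ c) (hcbar : 0 < cbar)
    (hJ : J.PosDef) (hD : D.PosSemidef) (hW : W.IsSymm) {x y a b : ι → ℝ}
    (hker₁ : cbar • (Bᵀ *ᵥ (B *ᵥ x)) + c • (D *ᵥ x - W *ᵥ x) + (D *ᵥ y - W *ᵥ y) = 0)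
    (hker₂ : D *ᵥ x - W *ᵥ x = 0)
    (hrange₁ : J *ᵥ x + cbar • (Bᵀ *ᵥ (B *ᵥ x)) + c • (D *ᵥ x) + D *ᵥ y =
      -(cbar • (Bᵀ *ᵥ (B *ᵥ a)) + c • (D *ᵥ a - W *ᵥ a) + (D *ᵥ b - W *ᵥ b)))
    (hrange₂ : J *ᵥ y - D *ᵥ x = D *ᵥ a - W *ᵥ a) :
    x = 0 ∧ y = 0 := by
  have hDs : D.IsSymm := by simpa [IsHermitian, IsSymm] using hD.isHermitian
  have swap {M : Matrix ι ι ℝ} (hM : M.IsSymm) (u v : ι → ℝ) :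
      u ⬝ᵥ M *ᵥ v = v ⬝ᵥ M *ᵥ u := by
    rw [dotProduct_mulVec, ← mulVec_transpose, hM.eq, dotProduct_comm]
  have gram (u v : ι → ℝ) : u ⬝ᵥ Bᵀ *ᵥ (B *ᵥ v) = (B *ᵥ u) ⬝ᵥ (B *ᵥ v) := by
    rw [dotProduct_mulVec, vecMul_transpose]
  have laplacian_x (u : ι → ℝ) : x ⬝ᵥ D *ᵥ u - x ⬝ᵥ W *ᵥ u = 0 := by
    rw [swap hDs, swap hW, ← dotProduct_sub, hker₂, dotProduct_zero]
  have hBx : B *ᵥ x = 0 := by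
    have h := congrArg (x ⬝ᵥ ·) hker₁
    simp only [hker₂, dotProduct_add, dotProduct_sub, dotProduct_smul, dotProduct_zero, gram,
      laplacian_x, smul_eq_mul, mul_zero, add_zero, mul_eq_zero, hcbar.ne', false_or] at h
    exact dotProduct_self_eq_zero.mp h
  have hy : D *ᵥ y - W *ᵥ y = 0 := by simpa [hBx, hker₂] using hker₁
  have laplacian_y (u : ι → ℝ) : y ⬝ᵥ D *ᵥ u - y ⬝ᵥ W *ᵥ u = 0 := by
    rw [swap hDs, swap hW, ← dotProduct_sub, hy, dotProduct_zero]
  have h₁ := congrArg (x ⬝ᵥ ·) hrange₁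
  have h₂ := congrArg (y ⬝ᵥ ·) hrange₂
  simp only [dotProduct_add, dotProduct_sub, dotProduct_smul, dotProduct_neg, gram, hBx,
    mulVec_zero, dotProduct_zero, zero_dotProduct, laplacian_x, laplacian_y, smul_eq_mul,
    mul_zero, add_zero, neg_zero] at h₁ h₂
  have hxD : 0 ≤ c * (x ⬝ᵥ D *ᵥ x) := mul_nonneg hc (by simpa using hD.dotProduct_mulVec_nonneg x)
  have hcross := swap hDs x y
  have nonneg (u : ι → ℝ) : 0 ≤ u ⬝ᵥ J *ᵥ u := by
    simpa using hJ.posSemidef.dotProduct_mulVec_nonneg u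
  have definite {u : ι → ℝ} (hu : u ⬝ᵥ J *ᵥ u ≤ 0) : u = 0 := by
    by_contra h
    exact hu.not_gt (by simpa using hJ.dotProduct_mulVec_pos h)
  exact ⟨definite (by linarith [nonneg y]), definite (by linarith [nonneg x])⟩

theorem stmt7 (m n : ℕ) (ni : Fin m → ℕ)
    (A : ∀ i, Matrix (Fin (ni i)) (Fin n) ℝ)
    (W : Matrix (Fin m) (Fin m) ℝ) (κ : Fin m → ℝ) (c cbar : ℝ)
    (hWsymm : W.IsSymm) (hWnn : ∀ i j, 0 ≤ W i j) (hWdiag : ∀ i, 0 < W i i)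
    (hκ : ∀ i, 0 < κ i) (hc : 0 ≤ c) (hcbar : 0 < cbar)
    (hE : IsUnit (Emat ni A W κ c cbar)) :
    ∀ v : ((Fin m × Fin n) ⊕ (Fin m × Fin n)) → ℝ,
      ((((Emat ni A W κ c cbar)⁻¹ * Fmat n W κ c) - 1) *
        (((Emat ni A W κ c cbar)⁻¹ * Fmat n W κ c) - 1)).mulVec v = 0 ↔
      (((Emat ni A W κ c cbar)⁻¹ * Fmat n W κ c) - 1).mulVec v = 0 := by
  intro v
  set E := Emat ni A W κ c cbar with hE_def
  set F := Fmat n W κ c with hF_def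
  have hER (u : (Fin m × Fin n) ⊕ (Fin m × Fin n) → ℝ) :
      E *ᵥ ((E⁻¹ * F - 1) *ᵥ u) = F *ᵥ u - E *ᵥ u := by
    rw [mulVec_mulVec, mul_sub, ← mul_assoc, mul_nonsing_inv _ ((isUnit_iff_isUnit_det _).mp hE),
      one_mul, mul_one, sub_mulVec]
  rw [← mulVec_mulVec]
  refine ⟨fun h => ?_, fun h => by rw [h, mulVec_zero]⟩
  set w := (E⁻¹ * F - 1) *ᵥ v
  have hker : F *ᵥ w - E *ᵥ w = 0 := by rw [← hER, h, mulVec_zero]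
  have hrange : E *ᵥ w = F *ᵥ v - E *ᵥ v := hER v
  clear_value w
  set K := bar n (diagonal κ) with hK
  set J : Matrix (Fin m × Fin n) (Fin m × Fin n) ℝ := diagonal fun p => (κ p.1)⁻¹ with hJ
  have hJK : J * K = 1 := by
    rw [hK, hJ, bar_diagonal, diagonal_mul_diagonal, ← diagonal_one]
    exact congrArg diagonal (funext fun p => inv_mul_cancel₀ (hκ p.1).ne')
  have hJpos : J.PosDef := PosDef.diagonal fun p => inv_pos.mpr (hκ p.1)
  have hDpos : (bar n (rowSumDiag W)).PosSemidef := by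
    rw [rowSumDiag, bar_diagonal]
    exact PosSemidef.diagonal fun p => Finset.sum_nonneg fun j _ => hWnn p.1 j
  rw [← Sum.elim_comp_inl_inr w, ← Sum.elim_comp_inl_inr v] at hrange
  rw [← Sum.elim_comp_inl_inr w] at hker ⊢
  generalize w ∘ Sum.inl = x at *
  generalize w ∘ Sum.inr = y at *
  generalize v ∘ Sum.inl = a at *
  generalize v ∘ Sum.inr = b at *
  have k₁ := congrArg (J *ᵥ · ∘ Sum.inl) hker
  have k₂ := congrArg (J *ᵥ · ∘ Sum.inr) hker
  have r₁ := congrArg (J *ᵥ · ∘ Sum.inl) hrange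
  have r₂ := congrArg (J *ᵥ · ∘ Sum.inr) hrange
  have JK (M : Matrix (Fin m × Fin n) (Fin m × Fin n) ℝ) : J * (K * M) = M := by
    rw [← mul_assoc, hJK, one_mul]
  simp only [hE_def, hF_def, Emat, Fmat, ← hK, fromBlocks_mulVec, Pi.sub_comp, Pi.zero_comp,
    Sum.elim_comp_inl, Sum.elim_comp_inr, mulVec_sub, mulVec_add, mulVec_smul, mulVec_neg,
    mulVec_zero, mulVec_mulVec, JK, add_mulVec, neg_mulVec, smul_mulVec, one_mulVec] at k₁ k₂ r₁ r₂
  obtain ⟨rfl, rfl⟩ := eq_zero_of_block_rows (_root_.blockDiag ni A) hc hcbar hJpos hDpos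
    (bar_isSymm n hWsymm) (x := x) (y := y) (a := a) (b := b)
    (by rw [mulVec_mulVec]; linear_combination (norm := module) -k₁)
    (by linear_combination (norm := module) k₂)
    (by simp only [mulVec_mulVec]; linear_combination (norm := module) r₁)
    (by linear_combination (norm := module) r₂)
  simp
end
end

section
/- Suppose W is an m×m real symmetric matrix with nonnegative entries and positive diagonal entries, κ_1,…,κ_m > 0, c ≥ 0, and c̄ ≥ 0. Then for every real number λ with |λ| > 1, the symmetric matrix M(λ) = (λD̄ − W̄) K̄ (λD̄ − W̄) + λ(λ−1) c̄ Ā'Ā + (λ−1)² K̄⁻¹ + (λ−1) c (λD̄ − W̄) is positive definite. -/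
open Matrix
open scoped Kronecker

noncomputable section

/-- The quadratic form of `μ (lam D - W)`, written as a symmetrized sum over pairs of indices. -/
lemma dotProduct_smul_rowSumDiag_sub_mulVec {m : ℕ} {W : Matrix (Fin m) (Fin m) ℝ}
    (hW : W.IsSymm) (lam μ : ℝ) (x : Fin m → ℝ) :
    x ⬝ᵥ ((μ • (lam • rowSumDiag W - W)) *ᵥ x) =
      ∑ i, ∑ j, W i j * (μ * (lam * ((x i ^ 2 + x j ^ 2) / 2) - x i * x j)) := by
  have hswap : ∑ i, ∑ j, W i j * x j ^ 2 = ∑ i, ∑ j, W i j * x i ^ 2 := by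
    rw [Finset.sum_comm]
    simp_rw [hW.apply]
  have hdiag : x ⬝ᵥ (rowSumDiag W *ᵥ x) = ∑ i, ∑ j, W i j * x i ^ 2 := by
    simp only [rowSumDiag, dotProduct, mulVec_diagonal, Finset.sum_mul, Finset.mul_sum]
    refine Finset.sum_congr rfl fun i _ => Finset.sum_congr rfl fun j _ => ?_
    ring
  have hoff : x ⬝ᵥ (W *ᵥ x) = ∑ i, ∑ j, W i j * (x i * x j) := by
    simp only [dotProduct, mulVec, Finset.mul_sum]
    refine Finset.sum_congr rfl fun i _ => Finset.sum_congr rfl fun j _ => ?_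
    ring
  have hsplit : ∑ i, ∑ j, W i j * (μ * (lam * ((x i ^ 2 + x j ^ 2) / 2) - x i * x j)) =
      μ * (lam / 2 * ((∑ i, ∑ j, W i j * x i ^ 2) + ∑ i, ∑ j, W i j * x j ^ 2)
        - ∑ i, ∑ j, W i j * (x i * x j)) := by
    simp only [← Finset.sum_add_distrib, Finset.mul_sum, ← Finset.sum_sub_distrib]
    refine Finset.sum_congr rfl fun i _ => Finset.sum_congr rfl fun j _ => ?_
    ring
  rw [hsplit, hswap, smul_mulVec, sub_mulVec, smul_mulVec, dotProduct_smul, dotProduct_sub,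
    dotProduct_smul, hdiag, hoff, smul_eq_mul, smul_eq_mul]
  ring

lemma isHermitian_smul_rowSumDiag_sub {m : ℕ} {W : Matrix (Fin m) (Fin m) ℝ}
    (hW : W.IsSymm) (lam : ℝ) : (lam • rowSumDiag W - W).IsHermitian := by
  rw [IsHermitian, conjTranspose_eq_transpose_of_trivial, transpose_sub, transpose_smul, hW.eq,
    rowSumDiag, diagonal_transpose]

lemma mul_sub_mul_nonneg_of_one_lt_abs {lam : ℝ} (hlam : 1 < |lam|) (a b : ℝ) :
    0 ≤ (lam - 1) * (lam * ((a ^ 2 + b ^ 2) / 2) - a * b) := by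
  rcases lt_abs.mp hlam with h | h
  · exact mul_nonneg (by linarith) (by nlinarith [sq_nonneg (a - b), sq_nonneg a, sq_nonneg b])
  · exact mul_nonneg_of_nonpos_of_nonpos (by linarith)
      (by nlinarith [sq_nonneg (a + b), sq_nonneg a, sq_nonneg b])

lemma posSemidef_sub_one_smul_rowSumDiag_sub {m : ℕ} {W : Matrix (Fin m) (Fin m) ℝ}
    (hW : W.IsSymm) (hWnn : ∀ i j, 0 ≤ W i j) {lam : ℝ} (hlam : 1 < |lam|) :
    ((lam - 1) • (lam • rowSumDiag W - W)).PosSemidef := by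
  refine .of_dotProduct_mulVec_nonneg
    ((isHermitian_smul_rowSumDiag_sub hW lam).smul (.all _)) fun x => ?_
  rw [star_trivial, dotProduct_smul_rowSumDiag_sub_mulVec hW]
  exact Finset.sum_nonneg fun i _ => Finset.sum_nonneg fun j _ =>
    mul_nonneg (hWnn i j) (mul_sub_mul_nonneg_of_one_lt_abs hlam _ _)

lemma bar_smul_sub {m : ℕ} (n : ℕ) (r : ℝ) (M N : Matrix (Fin m) (Fin m) ℝ) :
    bar n (r • M - N) = r • bar n M - bar n N := by
  ext p q
  simp [bar, kroneckerMap_apply, sub_mul, mul_assoc]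

lemma bar_smul {m : ℕ} (n : ℕ) (r : ℝ) (M : Matrix (Fin m) (Fin m) ℝ) :
    bar n (r • M) = r • bar n M :=
  smul_kronecker r M 1

lemma isHermitian_bar {m : ℕ} (n : ℕ) {M : Matrix (Fin m) (Fin m) ℝ} (hM : M.IsHermitian) :
    (bar n M).IsHermitian := by
  rw [IsHermitian, bar, conjTranspose_kronecker, hM.eq, conjTranspose_one]

theorem stmt9 (m n : ℕ) (ni : Fin m → ℕ)
    (A : ∀ i, Matrix (Fin (ni i)) (Fin n) ℝ)
    (W : Matrix (Fin m) (Fin m) ℝ) (κ : Fin m → ℝ) (c cbar : ℝ)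
    (hWsymm : W.IsSymm) (hWnn : ∀ i j, 0 ≤ W i j) (hWdiag : ∀ i, 0 < W i i)
    (hκ : ∀ i, 0 < κ i) (hc : 0 ≤ c) (hcbar : 0 ≤ cbar)
    (lam : ℝ) (hlam : 1 < |lam|) :
    ((lam • bar n (rowSumDiag W) - bar n W) * bar n (Matrix.diagonal κ)
        * (lam • bar n (rowSumDiag W) - bar n W)
      + (lam * (lam - 1) * cbar) • ((blockDiag ni A)ᵀ * blockDiag ni A)
      + ((lam - 1) ^ 2) • (bar n (Matrix.diagonal κ))⁻¹
      + ((lam - 1) * c) • (lam • bar n (rowSumDiag W) - bar n W)).PosDef := by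
  have hlam_one : lam ≠ 1 := by rintro rfl; simp at hlam
  have hlam_mul : 0 ≤ lam * (lam - 1) := by
    rcases lt_abs.mp hlam with h | h <;> nlinarith
  have hK : (bar n (Matrix.diagonal κ)).PosDef := (PosDef.diagonal hκ).kronecker .one
  have hB : (bar n (lam • rowSumDiag W - W)).IsHermitian :=
    isHermitian_bar n (isHermitian_smul_rowSumDiag_sub hWsymm lam)
  rw [← bar_smul_sub]
  have hquad := hK.posSemidef.conjTranspose_mul_mul_same (bar n (lam • rowSumDiag W - W))
  rw [hB.eq] at hquad
  have hA : ((blockDiag ni A)ᵀ * blockDiag ni A).PosSemidef := by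
    simpa using posSemidef_conjTranspose_mul_self (blockDiag ni A)
  have hlin : (((lam - 1) * c) • bar n (lam • rowSumDiag W - W)).PosSemidef := by
    rw [mul_comm, mul_smul, ← bar_smul]
    exact ((posSemidef_sub_one_smul_rowSumDiag_sub hWsymm hWnn hlam).kronecker .one).smul hc
  exact (PosDef.posSemidef_add (hquad.add (hA.smul (mul_nonneg hlam_mul hcbar)))
    (hK.inv.smul (sq_pos_of_ne_zero (sub_ne_zero.mpr hlam_one)))).add_posSemidef hlin
end
end

section
/- Let D be an m×m real diagonal matrix with positive diagonal entries and let W be an m×m real symmetric matrix such that D − W is positive semidefinite and D + W is positive definite. Then for every u ∈ ℝ^m, (D − W D⁻¹ W) u = 0 implies (D − W) u = 0. -/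
open Matrix

noncomputable section

theorem stmt13 (m : ℕ) (d : Fin m → ℝ) (hd : ∀ i, 0 < d i)
    (W : Matrix (Fin m) (Fin m) ℝ) (hW : W.IsSymm)
    (hpsd : (Matrix.diagonal d - W).PosSemidef)
    (hpd : (Matrix.diagonal d + W).PosDef) :
    ∀ u : Fin m → ℝ,
      (Matrix.diagonal d - W * (Matrix.diagonal d)⁻¹ * W).mulVec u = 0 →
      (Matrix.diagonal d - W).mulVec u = 0 := by
  intro u hu
  have hD : IsUnit (Matrix.diagonal d).det := by
    rw [Matrix.det_diagonal, isUnit_iff_ne_zero]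
    exact Finset.prod_ne_zero_iff.mpr fun i _ => (hd i).ne'
  have factor : Matrix.diagonal d - W * (Matrix.diagonal d)⁻¹ * W =
      (Matrix.diagonal d + W) * ((Matrix.diagonal d)⁻¹ * (Matrix.diagonal d - W)) := by
    rw [Matrix.mul_sub, Matrix.nonsing_inv_mul _ hD, Matrix.add_mul, Matrix.mul_sub,
      Matrix.mul_sub, Matrix.mul_nonsing_inv_cancel_left _ _ hD]
    simp only [Matrix.mul_one, Matrix.mul_assoc]
    abel
  rw [factor, ← Matrix.mulVec_mulVec] at hu
  have hv := Matrix.mulVec_injective_of_isUnit hpd.isUnit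
    (hu.trans (Matrix.mulVec_zero _).symm)
  have h := congrArg (Matrix.diagonal d).mulVec hv
  rwa [Matrix.mulVec_mulVec, Matrix.mul_nonsing_inv_cancel_left _ _ hD,
    Matrix.mulVec_zero] at h
end
end
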